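/- arXiv:1505.00964 — 2 statements merged into one kernel-verified Lean document; each statement's English description precedes it below -/
import Mathlib

section
/- For x = (x₁, x₂) ∈ ℝ², let (π(x)u)(t) = exp(πi·x₁x₂)·exp(2πi·t·x₂)·u(t + x₁) on 𝒮(ℝ, ℂ). Given any Schwartz kernel k ∈ 𝒮(ℝ², ℂ), define g(x₁, x₂) = exp(−πi·x₁x₂)·∫_ℝ k(t, x₁ + t)·exp(−2πi·t·x₂) dt. Then g is a Schwartz function on ℝ², and for every u ∈ 𝒮(ℝ, ℂ) and every t ∈ ℝ, ∫_{ℝ²} g(x₁, x₂)·(π(x)u)(t) dx = ∫_ℝ k(t, s)·u(s) ds; that is, every integral operator with Schwartz kernel is of the form π(g) for a unique explicitly recovered Schwartz symbol g. -/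
open Complex MeasureTheory

/-- The Heisenberg representation of `ℝ × ℝ^` on functions on `ℝ`:
`(π(x)u)(t) = exp(πi x₁x₂) exp(2πi t x₂) u(t + x₁)`. -/
noncomputable def heisRep (x : ℝ × ℝ) (u : ℝ → ℂ) : ℝ → ℂ :=
  fun t => Complex.exp ((Real.pi : ℂ) * Complex.I * (x.1 : ℂ) * (x.2 : ℂ)) *
    Complex.exp (2 * (Real.pi : ℂ) * Complex.I * (t : ℂ) * (x.2 : ℂ)) * u (t + x.1)

open scoped FourierTransform SchwartzMap LineDeriv

namespace SchwartzMap

/-- The restriction of a Schwartz function on the plane to a vertical line. -/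
noncomputable def slice (h : 𝓢(ℝ × ℝ, ℂ)) (x : ℝ) : 𝓢(ℝ, ℂ) :=
  compCLMOfAntilipschitz ℂ (K := 1) (g := fun t : ℝ => (x, t))
    (by
      have : (fun t : ℝ => (x, t)) = fun t => (x, (0 : ℝ)) + ContinuousLinearMap.inr ℝ ℝ ℝ t := by
        ext t <;> simp
      rw [this]
      fun_prop)
    (AntilipschitzWith.of_le_mul_dist fun s t => by simp [Prod.dist_eq]) h

@[simp]
lemma slice_apply (h : 𝓢(ℝ × ℝ, ℂ)) (x t : ℝ) : slice h x t = h (x, t) := rfl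

/-- The partial Fourier transform in the second variable. -/
noncomputable def partialFourierFun (h : 𝓢(ℝ × ℝ, ℂ)) (p : ℝ × ℝ) : ℂ := 𝓕 (slice h p.1) p.2

lemma partialFourierFun_eq_integral (h : 𝓢(ℝ × ℝ, ℂ)) (p : ℝ × ℝ) :
    partialFourierFun h p =
      ∫ t : ℝ, cexp (-(2 * (Real.pi : ℂ) * I * (t : ℂ) * (p.2 : ℂ))) * h (p.1, t) := by
  rw [partialFourierFun, fourier_coe, Real.fourier_real_eq_integral_exp_smul]
  refine integral_congr_ae (.of_forall fun t => ?_)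
  simp only [slice_apply, smul_eq_mul]
  congr 2
  push_cast
  ring

lemma norm_cexp_neg_two_pi_I_mul (t y : ℝ) :
    ‖cexp (-(2 * (Real.pi : ℂ) * I * (t : ℂ) * (y : ℂ)))‖ = 1 := by
  rw [show -(2 * (Real.pi : ℂ) * I * (t : ℂ) * (y : ℂ)) = ((-(2 * Real.pi * t * y) : ℝ) : ℂ) * I by
    push_cast; ring]
  exact norm_exp_ofReal_mul_I _

lemma exists_norm_apply_le_inv_one_add_sq (h : 𝓢(ℝ × ℝ, ℂ)) :
    ∃ C : ℝ, ∀ x t : ℝ, ‖h (x, t)‖ ≤ C * (1 + t ^ 2)⁻¹ := by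
  refine ⟨SchwartzMap.seminorm ℝ 0 0 h + SchwartzMap.seminorm ℝ 2 0 h, fun x t => ?_⟩
  rw [← div_eq_mul_inv, le_div_iff₀ (by positivity)]
  have h0 := norm_le_seminorm ℝ h (x, t)
  have h2 := norm_pow_mul_le_seminorm ℝ h 2 (x, t)
  have ht : t ^ 2 ≤ ‖(x, t)‖ ^ 2 := by
    rw [← sq_abs t]
    gcongr
    exact norm_snd_le (x, t)
  nlinarith [norm_nonneg (h (x, t))]

lemma exists_norm_partialFourierFun_le (h : 𝓢(ℝ × ℝ, ℂ)) :
    ∃ C : ℝ, ∀ p, ‖partialFourierFun h p‖ ≤ C := by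
  obtain ⟨C, hC⟩ := exists_norm_apply_le_inv_one_add_sq h
  refine ⟨∫ t : ℝ, C * (1 + t ^ 2)⁻¹, fun p => ?_⟩
  rw [partialFourierFun_eq_integral]
  refine norm_integral_le_of_norm_le (integrable_inv_one_add_sq.const_mul C)
    (.of_forall fun t => ?_)
  rw [norm_mul, norm_cexp_neg_two_pi_I_mul, one_mul]
  exact hC _ _

/-- Multiplication of a Schwartz function on the plane by the first coordinate. -/
noncomputable def fstMul (h : 𝓢(ℝ × ℝ, ℂ)) : 𝓢(ℝ × ℝ, ℂ) :=
  smulLeftCLM ℂ (ContinuousLinearMap.fst ℝ ℝ ℝ) h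

/-- Multiplication of a Schwartz function on the plane by `-2πi` times the second coordinate. -/
noncomputable def sndMul (h : 𝓢(ℝ × ℝ, ℂ)) : 𝓢(ℝ × ℝ, ℂ) :=
  (-(2 * (Real.pi : ℂ) * I)) • smulLeftCLM ℂ (ContinuousLinearMap.snd ℝ ℝ ℝ) h

lemma fstMul_apply (h : 𝓢(ℝ × ℝ, ℂ)) (p : ℝ × ℝ) : fstMul h p = p.1 * h p := by
  rw [fstMul, smulLeftCLM_apply_apply (ContinuousLinearMap.fst ℝ ℝ ℝ).hasTemperateGrowth]
  simp

lemma sndMul_apply (h : 𝓢(ℝ × ℝ, ℂ)) (p : ℝ × ℝ) :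
    sndMul h p = -(2 * (Real.pi : ℂ) * I * p.2) * h p := by
  rw [sndMul, smul_apply,
    smulLeftCLM_apply_apply (ContinuousLinearMap.snd ℝ ℝ ℝ).hasTemperateGrowth]
  simp [mul_assoc]

lemma partialFourierFun_fstMul (h : 𝓢(ℝ × ℝ, ℂ)) (p : ℝ × ℝ) :
    partialFourierFun (fstMul h) p = p.1 * partialFourierFun h p := by
  simp_rw [partialFourierFun_eq_integral, fstMul_apply, mul_left_comm, integral_const_mul]

lemma partialFourierFun_lineDeriv_snd (h : 𝓢(ℝ × ℝ, ℂ)) (p : ℝ × ℝ) :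
    partialFourierFun (∂_{((0 : ℝ), (1 : ℝ))} h) p =
      2 * (Real.pi : ℂ) * I * p.2 * partialFourierFun h p := by
  have hd : ⇑(slice (∂_{((0 : ℝ), (1 : ℝ))} h) p.1) = deriv (slice h p.1) := by
    ext t
    rw [slice_apply, lineDerivOp_apply_eq_fderiv]
    have h1 : HasDerivAt (fun t : ℝ => (p.1, t)) ((0 : ℝ), (1 : ℝ)) t :=
      (hasDerivAt_const t p.1).prodMk (hasDerivAt_id t)
    exact ((h.hasFDerivAt (p.1, t)).comp_hasDerivAt t h1).deriv.symm
  rw [partialFourierFun, fourier_coe, hd, Real.fourier_deriv (slice h p.1).integrable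
    (slice h p.1).differentiable (hd ▸ (slice _ p.1).integrable)]
  rfl

lemma hasFDerivAt_partialFourier_integrand (h : 𝓢(ℝ × ℝ, ℂ)) (p : ℝ × ℝ) (t : ℝ) :
    HasFDerivAt
      (fun q : ℝ × ℝ => cexp (-(2 * (Real.pi : ℂ) * I * (t : ℂ) * (q.2 : ℂ))) * h (q.1, t))
      ((ContinuousLinearMap.fst ℝ ℝ ℝ).smulRight
          (cexp (-(2 * (Real.pi : ℂ) * I * (t : ℂ) * (p.2 : ℂ))) *
            (∂_{((1 : ℝ), (0 : ℝ))} h) (p.1, t)) +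
        (ContinuousLinearMap.snd ℝ ℝ ℝ).smulRight
          (cexp (-(2 * (Real.pi : ℂ) * I * (t : ℂ) * (p.2 : ℂ))) * sndMul h (p.1, t))) p := by
  have h1 : HasFDerivAt (fun q : ℝ × ℝ => h (q.1, t)) _ p :=
    (h.hasFDerivAt (p.1, t)).comp p ((hasFDerivAt_fst (p := p)).prodMk (hasFDerivAt_const t p))
  have h2 : HasFDerivAt (fun q : ℝ × ℝ => (q.2 : ℂ)) _ p :=
    ofRealCLM.hasFDerivAt.comp p (hasFDerivAt_snd (p := p))
  have h3 := ((h2.const_mul (2 * (Real.pi : ℂ) * I * (t : ℂ))).neg.cexp).mul h1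
  refine h3.congr_fderiv ?_
  ext
  · simp [lineDerivOp_apply_eq_fderiv]
  · simp [sndMul_apply, show ((0 : ℝ), (0 : ℝ)) = 0 from rfl]
    ring

lemma hasFDerivAt_partialFourierFun (h : 𝓢(ℝ × ℝ, ℂ)) (p : ℝ × ℝ) :
    HasFDerivAt (partialFourierFun h)
      ((ContinuousLinearMap.fst ℝ ℝ ℝ).smulRight
          (partialFourierFun (∂_{((1 : ℝ), (0 : ℝ))} h) p) +
        (ContinuousLinearMap.snd ℝ ℝ ℝ).smulRight (partialFourierFun (sndMul h) p)) p := by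
  have hcont (f : 𝓢(ℝ × ℝ, ℂ)) (q : ℝ × ℝ) : Continuous fun t : ℝ =>
      cexp (-(2 * (Real.pi : ℂ) * I * (t : ℂ) * (q.2 : ℂ))) * f (q.1, t) := by fun_prop
  have hint (f : 𝓢(ℝ × ℝ, ℂ)) (q : ℝ × ℝ) : Integrable fun t : ℝ =>
      cexp (-(2 * (Real.pi : ℂ) * I * (t : ℂ) * (q.2 : ℂ))) * f (q.1, t) := by
    refine (slice f q.1).integrable.mono (hcont f q).aestronglyMeasurable (.of_forall fun t => ?_)
    rw [norm_mul, norm_cexp_neg_two_pi_I_mul, one_mul, slice_apply]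
  obtain ⟨C, hC⟩ := exists_norm_apply_le_inv_one_add_sq (∂_{((1 : ℝ), (0 : ℝ))} h)
  obtain ⟨D, hD⟩ := exists_norm_apply_le_inv_one_add_sq (sndMul h)
  have hL (L : ℝ × ℝ →L[ℝ] ℝ) (f : 𝓢(ℝ × ℝ, ℂ)) : Integrable fun t : ℝ => L.smulRight
      (cexp (-(2 * (Real.pi : ℂ) * I * (t : ℂ) * (p.2 : ℂ))) * f (p.1, t)) :=
    (ContinuousLinearMap.smulRightL ℝ (ℝ × ℝ) ℂ L).integrable_comp (hint f p)
  have hI (L : ℝ × ℝ →L[ℝ] ℝ) (f : 𝓢(ℝ × ℝ, ℂ)) : ∫ t : ℝ, L.smulRight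
      (cexp (-(2 * (Real.pi : ℂ) * I * (t : ℂ) * (p.2 : ℂ))) * f (p.1, t)) =
      L.smulRight (partialFourierFun f p) := by
    rw [partialFourierFun_eq_integral]
    exact (ContinuousLinearMap.smulRightL ℝ (ℝ × ℝ) ℂ L).integral_comp_comm (hint f p)
  have key := hasFDerivAt_integral_of_dominated_of_fderiv_le (𝕜 := ℝ) (μ := volume) (s := Set.univ)
    (bound := fun t : ℝ => C * (1 + t ^ 2)⁻¹ + D * (1 + t ^ 2)⁻¹) Filter.univ_mem
    (.of_forall fun q => (hcont h q).aestronglyMeasurable) (hint h p)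
    ((hL (.fst ℝ ℝ ℝ) (∂_{((1 : ℝ), (0 : ℝ))} h)).aestronglyMeasurable.add
      (hL (.snd ℝ ℝ ℝ) (sndMul h)).aestronglyMeasurable)
    (.of_forall fun t q _ => ?_)
    ((integrable_inv_one_add_sq.const_mul C).add (integrable_inv_one_add_sq.const_mul D))
    (.of_forall fun t q _ => hasFDerivAt_partialFourier_integrand h q t)
  · rw [integral_add (hL _ _) (hL _ _), hI, hI] at key
    rwa [funext (partialFourierFun_eq_integral h)]
  · refine (norm_add_le _ _).trans ?_
    rw [ContinuousLinearMap.norm_smulRight_apply, ContinuousLinearMap.norm_smulRight_apply,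
      norm_mul, norm_mul, norm_cexp_neg_two_pi_I_mul, one_mul, one_mul]
    exact add_le_add
      ((mul_le_of_le_one_left (norm_nonneg _) (ContinuousLinearMap.norm_fst_le _ _ _)).trans
        (hC _ _))
      ((mul_le_of_le_one_left (norm_nonneg _) (ContinuousLinearMap.norm_snd_le _ _ _)).trans
        (hD _ _))

lemma fderiv_partialFourierFun (h : 𝓢(ℝ × ℝ, ℂ)) :
    fderiv ℝ (partialFourierFun h) =
      ContinuousLinearMap.smulRightL ℝ (ℝ × ℝ) ℂ (ContinuousLinearMap.fst ℝ ℝ ℝ) ∘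
          partialFourierFun (∂_{((1 : ℝ), (0 : ℝ))} h) +
        ContinuousLinearMap.smulRightL ℝ (ℝ × ℝ) ℂ (ContinuousLinearMap.snd ℝ ℝ ℝ) ∘
          partialFourierFun (sndMul h) :=
  funext fun p => (hasFDerivAt_partialFourierFun h p).fderiv

lemma contDiff_partialFourierFun (n : ℕ) (h : 𝓢(ℝ × ℝ, ℂ)) :
    ContDiff ℝ n (partialFourierFun h) := by
  induction n generalizing h with
  | zero =>
    exact contDiff_zero.2 <| continuous_iff_continuousAt.2 fun p =>
      (hasFDerivAt_partialFourierFun h p).continuousAt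
  | succ n ih =>
    push_cast
    refine contDiff_succ_iff_fderiv.2
      ⟨fun p => (hasFDerivAt_partialFourierFun h p).differentiableAt, by simp, ?_⟩
    rw [fderiv_partialFourierFun]
    exact ((ContinuousLinearMap.contDiff _).comp (ih _)).add
      ((ContinuousLinearMap.contDiff _).comp (ih _))

lemma exists_fst_pow_mul_norm_partialFourierFun_le (k : ℕ) (h : 𝓢(ℝ × ℝ, ℂ)) :
    ∃ C : ℝ, ∀ p : ℝ × ℝ, ‖p.1‖ ^ k * ‖partialFourierFun h p‖ ≤ C := by
  induction k generalizing h with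
  | zero => simpa using exists_norm_partialFourierFun_le h
  | succ k ih =>
    obtain ⟨C, hC⟩ := ih (fstMul h)
    refine ⟨C, fun p => le_of_eq_of_le ?_ (hC p)⟩
    rw [partialFourierFun_fstMul, norm_mul, norm_real]
    ring

lemma exists_snd_pow_mul_norm_partialFourierFun_le (k : ℕ) (h : 𝓢(ℝ × ℝ, ℂ)) :
    ∃ C : ℝ, ∀ p : ℝ × ℝ, ‖p.2‖ ^ k * ‖partialFourierFun h p‖ ≤ C := by
  induction k generalizing h with
  | zero => simpa using exists_norm_partialFourierFun_le h
  | succ k ih =>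
    obtain ⟨C, hC⟩ := ih (∂_{((0 : ℝ), (1 : ℝ))} h)
    refine ⟨C, fun p => le_trans ?_ (hC p)⟩
    have hpi : (1 : ℝ) ≤ ‖2 * (Real.pi : ℂ) * I‖ := by
      simp only [norm_mul, norm_ofNat, norm_real, norm_I, mul_one, Real.norm_eq_abs,
        abs_of_pos Real.pi_pos]
      linarith [Real.pi_gt_three]
    rw [partialFourierFun_lineDeriv_snd, norm_mul, norm_mul, norm_real]
    calc ‖p.2‖ ^ (k + 1) * ‖partialFourierFun h p‖
        = 1 * (‖p.2‖ ^ (k + 1) * ‖partialFourierFun h p‖) := (one_mul _).symm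
      _ ≤ ‖2 * (Real.pi : ℂ) * I‖ * (‖p.2‖ ^ (k + 1) * ‖partialFourierFun h p‖) := by gcongr
      _ = _ := by ring

lemma exists_pow_mul_norm_iteratedFDeriv_partialFourierFun_le (k n : ℕ) (h : 𝓢(ℝ × ℝ, ℂ)) :
    ∃ C : ℝ, ∀ p : ℝ × ℝ, ‖p‖ ^ k * ‖iteratedFDeriv ℝ n (partialFourierFun h) p‖ ≤ C := by
  induction n generalizing h with
  | zero =>
    obtain ⟨C, hC⟩ := exists_fst_pow_mul_norm_partialFourierFun_le k h
    obtain ⟨D, hD⟩ := exists_snd_pow_mul_norm_partialFourierFun_le k h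
    refine ⟨max C D, fun p => ?_⟩
    rw [norm_iteratedFDeriv_zero, Prod.norm_def]
    rcases max_choice ‖p.1‖ ‖p.2‖ with hp | hp <;> rw [hp]
    · exact (hC p).trans (le_max_left _ _)
    · exact (hD p).trans (le_max_right _ _)
  | succ n ih =>
    obtain ⟨C, hC⟩ := ih (∂_{((1 : ℝ), (0 : ℝ))} h)
    obtain ⟨D, hD⟩ := ih (sndMul h)
    set L := ContinuousLinearMap.smulRightL ℝ (ℝ × ℝ) ℂ (ContinuousLinearMap.fst ℝ ℝ ℝ)
    set M := ContinuousLinearMap.smulRightL ℝ (ℝ × ℝ) ℂ (ContinuousLinearMap.snd ℝ ℝ ℝ)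
    refine ⟨‖L‖ * C + ‖M‖ * D, fun p => ?_⟩
    have h1 := contDiff_partialFourierFun n (∂_{((1 : ℝ), (0 : ℝ))} h)
    have h2 := contDiff_partialFourierFun n (sndMul h)
    rw [← norm_iteratedFDeriv_fderiv, fderiv_partialFourierFun,
      iteratedFDeriv_add (L.contDiff.comp h1) (M.contDiff.comp h2)]
    calc _ ≤ ‖p‖ ^ k * (‖L‖ * ‖iteratedFDeriv ℝ n (partialFourierFun (∂_{((1 : ℝ), (0 : ℝ))} h)) p‖
          + ‖M‖ * ‖iteratedFDeriv ℝ n (partialFourierFun (sndMul h)) p‖) := by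
          gcongr
          exact (norm_add_le _ _).trans (add_le_add
            (L.norm_iteratedFDeriv_comp_left h1.contDiffAt le_rfl)
            (M.norm_iteratedFDeriv_comp_left h2.contDiffAt le_rfl))
      _ = ‖L‖ * (‖p‖ ^ k * ‖iteratedFDeriv ℝ n (partialFourierFun (∂_{((1 : ℝ), (0 : ℝ))} h)) p‖)
          + ‖M‖ * (‖p‖ ^ k * ‖iteratedFDeriv ℝ n (partialFourierFun (sndMul h)) p‖) := by ring
      _ ≤ _ := by
          gcongr
          · exact hC p
          · exact hD p

/-- The partial Fourier transform of a Schwartz function on the plane is a Schwartz function. -/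
noncomputable def partialFourier (h : 𝓢(ℝ × ℝ, ℂ)) : 𝓢(ℝ × ℝ, ℂ) where
  toFun := partialFourierFun h
  smooth' := contDiff_infty.2 fun n => contDiff_partialFourierFun n h
  decay' k n := exists_pow_mul_norm_iteratedFDeriv_partialFourierFun_le k n h

lemma partialFourier_apply (h : 𝓢(ℝ × ℝ, ℂ)) (p : ℝ × ℝ) :
    partialFourier h p = 𝓕 (slice h p.1) p.2 := rfl

/-- The symmetrising change of variables `(x, s) ↦ (s - x / 2, s + x / 2)`. -/
noncomputable def symmShear : (ℝ × ℝ) ≃L[ℝ] (ℝ × ℝ) :=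
  LinearEquiv.toContinuousLinearEquiv
    { toFun := fun p => (p.2 - p.1 / 2, p.2 + p.1 / 2)
      invFun := fun q => (q.2 - q.1, (q.1 + q.2) / 2)
      map_add' := fun p q => by ext <;> simp <;> ring
      map_smul' := fun c p => by ext <;> simp <;> ring
      left_inv := fun p => by ext <;> simp
      right_inv := fun q => by ext <;> simp <;> ring }

/-- The kernel `k` in the symmetric coordinates `(x, s) ↦ k (s - x / 2, s + x / 2)`. -/
noncomputable def symmKernel (k : 𝓢(ℝ × ℝ, ℂ)) : 𝓢(ℝ × ℝ, ℂ) :=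
  compCLMOfContinuousLinearEquiv ℂ symmShear k

lemma symmKernel_apply (k : 𝓢(ℝ × ℝ, ℂ)) (x s : ℝ) :
    symmKernel k (x, s) = k (s - x / 2, s + x / 2) := rfl

lemma partialFourier_symmKernel (k : 𝓢(ℝ × ℝ, ℂ)) (x : ℝ × ℝ) :
    partialFourier (symmKernel k) x =
      cexp (-((Real.pi : ℂ) * I * (x.1 : ℂ) * (x.2 : ℂ))) *
        ∫ t : ℝ, k (t, x.1 + t) * cexp (-(2 * (Real.pi : ℂ) * I * (t : ℂ) * (x.2 : ℂ))) := by
  change partialFourierFun _ _ = _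
  rw [partialFourierFun_eq_integral, ← integral_add_right_eq_self _ (x.1 / 2),
    ← integral_const_mul]
  refine integral_congr_ae (.of_forall fun t => ?_)
  simp only [symmKernel_apply]
  rw [mul_left_comm, ← exp_add, mul_comm]
  congr 2
  · ext <;> ring
  · push_cast
    ring

lemma integral_partialFourier_mul_cexp (h : 𝓢(ℝ × ℝ, ℂ)) (x t : ℝ) :
    ∫ y : ℝ, partialFourier h (x, y) * cexp (2 * (Real.pi : ℂ) * I * (t : ℂ) * (y : ℂ)) =
      h (x, t) := by
  have hinv : 𝓕⁻ (𝓕 (slice h x)) = slice h x := FourierTransform.fourierInv_fourier_eq _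
  rw [← slice_apply, ← hinv, fourierInv_coe, Real.fourierInv_eq']
  refine integral_congr_ae (.of_forall fun y => ?_)
  simp only [partialFourier_apply, smul_eq_mul, RCLike.inner_apply, conj_trivial]
  rw [mul_comm]
  congr 2
  push_cast
  ring

end SchwartzMap

lemma norm_heisRep (x : ℝ × ℝ) (u : ℝ → ℂ) (t : ℝ) : ‖heisRep x u t‖ = ‖u (t + x.1)‖ := by
  rw [heisRep, ← exp_add, norm_mul, show (Real.pi : ℂ) * I * (x.1 : ℂ) * (x.2 : ℂ) +
    2 * (Real.pi : ℂ) * I * (t : ℂ) * (x.2 : ℂ) =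
      ((Real.pi * x.1 * x.2 + 2 * Real.pi * t * x.2 : ℝ) : ℂ) * I by push_cast; ring,
    norm_exp_ofReal_mul_I, one_mul]

lemma integrable_mul_heisRep (G : 𝓢(ℝ × ℝ, ℂ)) (u : 𝓢(ℝ, ℂ)) (t : ℝ) :
    Integrable fun x : ℝ × ℝ => G x * heisRep x u t := by
  refine G.integrable.mul_bdd (c := SchwartzMap.seminorm ℝ 0 0 u) ?_ (.of_forall fun x => ?_)
  · unfold heisRep
    exact Continuous.aestronglyMeasurable (by fun_prop)
  · rw [norm_heisRep]
    exact u.norm_le_seminorm ℝ _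

/-- Every integral operator with Schwartz kernel `k` is of the form `π(g)` for the
explicitly recovered Schwartz symbol
`g(x₁,x₂) = exp(−πi x₁x₂) ∫ k(t, x₁+t) exp(−2πi t x₂) dt` (which is the trace
`Tr(π(x)* K)`). -/
theorem integral_operator_is_integrated_heisenberg (k : SchwartzMap (ℝ × ℝ) ℂ) :
    let g : ℝ × ℝ → ℂ := fun x =>
      Complex.exp (-((Real.pi : ℂ) * Complex.I * (x.1 : ℂ) * (x.2 : ℂ))) *
        ∫ t : ℝ, k (t, x.1 + t) * Complex.exp (-(2 * (Real.pi : ℂ) * Complex.I * (t : ℂ) * (x.2 : ℂ)))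
    (∃ G : SchwartzMap (ℝ × ℝ) ℂ, ∀ x : ℝ × ℝ, G x = g x) ∧
    ∀ (u : SchwartzMap ℝ ℂ) (t : ℝ),
      ∫ x : ℝ × ℝ, g x * heisRep x (⇑u) t = ∫ s : ℝ, k (t, s) * u s := by
  intro g
  have hg : ∀ x, (SchwartzMap.symmKernel k).partialFourier x = g x :=
    SchwartzMap.partialFourier_symmKernel k
  refine ⟨⟨_, hg⟩, fun u t => ?_⟩
  simp_rw [← hg]
  rw [Measure.volume_eq_prod, integral_prod _ (integrable_mul_heisRep _ u t),
    ← integral_add_left_eq_self (fun s => k (t, s) * u s) t]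
  refine integral_congr_ae (.of_forall fun x => ?_)
  have hx := SchwartzMap.integral_partialFourier_mul_cexp (SchwartzMap.symmKernel k) x (t + x / 2)
  rw [SchwartzMap.symmKernel_apply, add_sub_cancel_right, add_assoc, add_halves] at hx
  simp only [← hx, heisRep]
  rw [← integral_mul_const]
  refine integral_congr_ae (.of_forall fun y => ?_)
  simp only [← exp_add, ← mul_assoc]
  congr 3
  push_cast
  ring
end

section
/- Let α₀, α₁ be natural numbers with α₁ ≥ 1, let m be a natural number, and let u, v > 0. Then ∫₀^∞ x^{m+1}·(1 + x)^{−α₀−1}·(x + u)^{−α₁−1}·(x + v)^{−1} dx = (1/α₁)·( α₁·I(u) + u·I′(u) ), where I(w) = ∫₀^∞ x^m·(1 + x)^{−α₀−1}·(x + w)^{−α₁}·(x + v)^{−1} dx and I′ denotes the derivative of I in the variable w evaluated at u. In other words, the moment-raised integral H(u,v,m+1) with exponent α₁ equals (1/α₁)(α₁ + u·∂_u) applied to the integral with exponent α₁ − 1 and moment m. -/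
open MeasureTheory

open Set

/-- Comparable shifts give comparable inverse powers: if `x + b ≤ 2 (x + a)`, then
`(x + a)⁻ⁿ ≤ 2ⁿ (x + b)⁻ⁿ`. -/
lemma inv_add_pow_le_two_pow_mul {a b x : ℝ} (hb : 0 < x + b)
    (hab : x + b ≤ 2 * (x + a)) (n : ℕ) :
    ((x + a) ^ n)⁻¹ ≤ 2 ^ n * ((x + b) ^ n)⁻¹ := by
  have ha : 0 < x + a := by linarith
  have h : (x + b) ^ n ≤ 2 ^ n * (x + a) ^ n := by
    rw [← mul_pow]
    exact pow_le_pow_left₀ hb.le hab n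
  rw [← div_eq_mul_inv, inv_le_comm₀ (by positivity) (by positivity), inv_div,
    div_le_iff₀ (by positivity)]
  linarith

lemma integrableOn_mul_inv_add_pow_of_le {g : ℝ → ℝ} (hg : Measurable g) {a b : ℝ}
    (hb : 0 < b) (hab : b ≤ 2 * a) {n : ℕ}
    (h : IntegrableOn (fun x => g x * ((x + b) ^ n)⁻¹) (Ioi 0)) :
    IntegrableOn (fun x => g x * ((x + a) ^ n)⁻¹) (Ioi 0) := by
  refine Integrable.mono' (h.norm.const_mul (2 ^ n)) (by fun_prop) ?_
  refine (ae_restrict_mem measurableSet_Ioi).mono fun x (hx : 0 < x) => ?_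
  have ha : 0 < x + a := by linarith
  have hxb : 0 < x + b := by linarith
  have key := inv_add_pow_le_two_pow_mul hxb (by linarith : x + b ≤ 2 * (x + a)) n
  rw [norm_mul, norm_mul, Real.norm_of_nonneg (by positivity : 0 ≤ ((x + a) ^ n)⁻¹),
    Real.norm_of_nonneg (by positivity : 0 ≤ ((x + b) ^ n)⁻¹), mul_left_comm]
  gcongr

lemma hasDerivAt_inv_add_pow {x w : ℝ} (h : x + w ≠ 0) (n : ℕ) :
    HasDerivAt (fun w => ((x + w) ^ n)⁻¹) (-(n * ((x + w) ^ (n + 1))⁻¹)) w := by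
  have := (((hasDerivAt_id w).const_add x).fun_pow n).fun_inv (pow_ne_zero n h)
  refine this.congr_deriv ?_
  rcases n with _ | n
  · simp
  · simp only [id, Nat.add_sub_cancel]
    field_simp
    ring

lemma hasDerivAt_integral_mul_inv_add_pow {g : ℝ → ℝ} (hg : Measurable g) {u : ℝ}
    (hu : 0 < u) {n : ℕ} (h : IntegrableOn (fun x => g x * ((x + u) ^ n)⁻¹) (Ioi 0)) :
    IntegrableOn (fun x => g x * -(n * ((x + u) ^ (n + 1))⁻¹)) (Ioi 0) ∧
      HasDerivAt (fun w => ∫ x in Ioi (0 : ℝ), g x * ((x + w) ^ n)⁻¹)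
        (∫ x in Ioi (0 : ℝ), g x * -(n * ((x + u) ^ (n + 1))⁻¹)) u := by
  refine hasDerivAt_integral_of_dominated_loc_of_deriv_le
    (F := fun w x => g x * ((x + w) ^ n)⁻¹)
    (F' := fun w x => g x * -(n * ((x + w) ^ (n + 1))⁻¹))
    (bound := fun x => n * 2 ^ (n + 1) * u⁻¹ * ‖g x * ((x + u) ^ n)⁻¹‖)
    (Ioi_mem_nhds (half_lt_self hu)) (.of_forall fun w => by fun_prop) h (by fun_prop) ?_
    (h.norm.const_mul _) ?_
  · refine (ae_restrict_mem measurableSet_Ioi).mono fun x (hx : 0 < x) w (hw : u / 2 < w) => ?_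
    have hxw : 0 < x + w := by linarith
    have hxu : 0 < x + u := by linarith
    have key := inv_add_pow_le_two_pow_mul hxu (by linarith : x + u ≤ 2 * (x + w)) (n + 1)
    have hinv : (x + u)⁻¹ ≤ u⁻¹ := inv_anti₀ hu (by linarith)
    rw [norm_mul, norm_neg, norm_mul, norm_mul,
      Real.norm_of_nonneg (by positivity : 0 ≤ ((x + w) ^ (n + 1))⁻¹),
      Real.norm_of_nonneg (by positivity : 0 ≤ ((x + u) ^ n)⁻¹), Real.norm_natCast]
    calc ‖g x‖ * (n * ((x + w) ^ (n + 1))⁻¹)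
        ≤ ‖g x‖ * (n * (2 ^ (n + 1) * ((x + u) ^ (n + 1))⁻¹)) := by gcongr
      _ = n * 2 ^ (n + 1) * (x + u)⁻¹ * (‖g x‖ * ((x + u) ^ n)⁻¹) := by
        rw [pow_succ (x + u), mul_inv]
        ring
      _ ≤ n * 2 ^ (n + 1) * u⁻¹ * (‖g x‖ * ((x + u) ^ n)⁻¹) := by gcongr
  · refine (ae_restrict_mem measurableSet_Ioi).mono fun x (hx : 0 < x) w (hw : u / 2 < w) => ?_
    exact (hasDerivAt_inv_add_pow (by linarith : 0 < x + w).ne' n).const_mul (g x)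

/-- For a weight that is continuous near the origin, raising both the moment and the exponent
cannot create integrability. -/
lemma integrableOn_mul_inv_add_pow_of_succ {g : ℝ → ℝ} (hg : Measurable g)
    (hgc : ContinuousOn g (Icc 0 1)) {u : ℝ} (hu : 0 < u) {n : ℕ}
    (h : IntegrableOn (fun x => x * g x * ((x + u) ^ (n + 1))⁻¹) (Ioi 0)) :
    IntegrableOn (fun x => g x * ((x + u) ^ n)⁻¹) (Ioi 0) := by
  rw [← Ioc_union_Ioi_eq_Ioi zero_le_one]
  refine IntegrableOn.union ?_ ?_
  · have hc : ContinuousOn (fun x => g x * ((x + u) ^ n)⁻¹) (Icc 0 1) := by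
      refine hgc.mul (ContinuousOn.inv₀ (by fun_prop) fun x hx => ?_)
      have : 0 < x + u := by linarith [hx.1]
      positivity
    exact (hc.integrableOn_Icc).mono_set Ioc_subset_Icc_self
  · have h1 := h.mono_set (Ioi_subset_Ioi zero_le_one)
    refine Integrable.mono' (h1.norm.const_mul (1 + u)) (by fun_prop) ?_
    refine (ae_restrict_mem measurableSet_Ioi).mono fun x (hx : 1 < x) => ?_
    have hxu : 0 < x + u := by linarith
    have hx0 : 0 < x := by linarith
    have hle : x + u ≤ (1 + u) * x := by nlinarith
    rw [norm_mul, norm_mul, norm_mul, Real.norm_of_nonneg hx0.le,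
      Real.norm_of_nonneg (by positivity : 0 ≤ ((x + u) ^ n)⁻¹),
      Real.norm_of_nonneg (by positivity : 0 ≤ ((x + u) ^ (n + 1))⁻¹)]
    calc ‖g x‖ * ((x + u) ^ n)⁻¹
        = (x + u) * (‖g x‖ * ((x + u) ^ (n + 1))⁻¹) := by
          field_simp
          ring
      _ ≤ (1 + u) * x * (‖g x‖ * ((x + u) ^ (n + 1))⁻¹) := by gcongr
      _ = (1 + u) * (x * ‖g x‖ * ((x + u) ^ (n + 1))⁻¹) := by ring

/-- The moment-raising recursion for a general weight. If the integrals diverge, then both sides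
vanish. -/
lemma natCast_mul_integral_mul_inv_add_pow_succ {g : ℝ → ℝ} (hg : Measurable g)
    (hgc : ContinuousOn g (Icc 0 1)) {u : ℝ} (hu : 0 < u) (n : ℕ) :
    n * ∫ x in Ioi (0 : ℝ), x * g x * ((x + u) ^ (n + 1))⁻¹ =
      n * (∫ x in Ioi (0 : ℝ), g x * ((x + u) ^ n)⁻¹) +
        u * deriv (fun w => ∫ x in Ioi (0 : ℝ), g x * ((x + w) ^ n)⁻¹) u := by
  by_cases h : IntegrableOn (fun x => g x * ((x + u) ^ n)⁻¹) (Ioi 0)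
  · obtain ⟨hint, hderiv⟩ := hasDerivAt_integral_mul_inv_add_pow hg hu h
    rw [hderiv.deriv, ← integral_const_mul, ← integral_const_mul, ← integral_const_mul,
      ← integral_add (h.const_mul _) (hint.const_mul _)]
    refine setIntegral_congr_fun measurableSet_Ioi fun x (hx : 0 < x) => ?_
    have hxu : x + u ≠ 0 := by positivity
    field_simp
    ring
  · have hzero : (fun w => ∫ x in Ioi (0 : ℝ), g x * ((x + w) ^ n)⁻¹) =ᶠ[nhds u]
        fun _ => (0 : ℝ) := by
      filter_upwards [Ioo_mem_nhds hu (by linarith : u < 2 * u)] with w hw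
      exact integral_undef fun hint =>
        h (integrableOn_mul_inv_add_pow_of_le hg hw.1 hw.2.le hint)
    rw [hzero.deriv_eq, integral_undef h, integral_undef fun hint =>
      h (integrableOn_mul_inv_add_pow_of_succ hg hgc hu hint)]
    simp

/-- The recursion (EqTwoVarIntB): with
`I(w) = ∫₀^∞ x^m (1+x)^{−α₀−1}(x+w)^{−α₁}(x+v)^{−1} dx`, the moment-raised
integral with exponent `α₁` satisfies
`∫₀^∞ x^{m+1}(1+x)^{−α₀−1}(x+u)^{−α₁−1}(x+v)^{−1} dx = (1/α₁)(α₁ I(u) + u I′(u))`. -/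
theorem moment_raising_recursion (α₀ α₁ m : ℕ) (hα₁ : 1 ≤ α₁)
    (u v : ℝ) (hu : 0 < u) (hv : 0 < v) :
    let I : ℝ → ℝ := fun w => ∫ x in Set.Ioi (0 : ℝ),
      x ^ m * ((1 + x) ^ (α₀ + 1))⁻¹ * ((x + w) ^ α₁)⁻¹ * (x + v)⁻¹
    ∫ x in Set.Ioi (0 : ℝ),
        x ^ (m + 1) * ((1 + x) ^ (α₀ + 1))⁻¹ * ((x + u) ^ (α₁ + 1))⁻¹ * (x + v)⁻¹
      = (1 / (α₁ : ℝ)) * ((α₁ : ℝ) * I u + u * deriv I u) := by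
  intro I
  let g : ℝ → ℝ := fun x => x ^ m * ((1 + x) ^ (α₀ + 1))⁻¹ * (x + v)⁻¹
  have hg : Measurable g := by fun_prop
  have hgc : ContinuousOn g (Icc 0 1) := by
    refine ContinuousOn.mul (ContinuousOn.mul (by fun_prop)
      (ContinuousOn.inv₀ (by fun_prop) fun x hx => ?_))
      (ContinuousOn.inv₀ (by fun_prop) fun x hx => ?_)
    · have : 0 < 1 + x := by linarith [hx.1]
      positivity
    · linarith [hx.1]
  have hI : I = fun w => ∫ x in Ioi (0 : ℝ), g x * ((x + w) ^ α₁)⁻¹ := by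
    funext w
    exact integral_congr_ae (.of_forall fun x => mul_right_comm _ _ _)
  have hJ : ∀ x, x ^ (m + 1) * ((1 + x) ^ (α₀ + 1))⁻¹ * ((x + u) ^ (α₁ + 1))⁻¹ * (x + v)⁻¹ =
      x * g x * ((x + u) ^ (α₁ + 1))⁻¹ := fun x => by
    simp only [g]
    ring
  have hα : (α₁ : ℝ) ≠ 0 := by positivity
  simp only [hJ, hI]
  rw [← natCast_mul_integral_mul_inv_add_pow_succ hg hgc hu, one_div, inv_mul_cancel_left₀ hα]
end
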